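/- arXiv:1401.2748 — 2 statements merged into one kernel-verified Lean document; each statement's English description precedes it below -/
import Mathlib

section
/- [Duality] Let char F = p > 0 and r \u2264 min{s, s', p^m}. If s' \u2261 -s (mod p^m), then \u03b5(r,s',p) is the negative reverse of \u03b5(r,s,p); i.e., if \u03b5(r,s,p) = (\u03b5_1, \u2026, \u03b5_r), then \u03b5(r,s',p) = (-\u03b5_r, \u2026, -\u03b5_1). -/
open Matrix Kronecker

/-- The `k × k` upper-triangular Jordan block with eigenvalue `1`. -/
def jordanBlock (F : Type*) [Zero F] [One F] (k : ℕ) : Matrix (Fin k) (Fin k) F :=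
  Matrix.of fun i j => if j = i then 1 else if (j : ℕ) = (i : ℕ) + 1 then 1 else 0

/-- `lam : Fin r → ℕ` is the Jordan partition of the square matrix `M`
(with eigenvalue 1), characterized by: `lam` is weakly decreasing with positive
parts, and for every `k` the rank of `(M - 1)^k` equals `∑ i, max (lam i - k) 0`.
Over a field this holds iff `M` is similar to the direct sum of the unipotent
Jordan blocks `J_{lam i}`. -/
def IsJordanSeq {F : Type*} [CommRing F] {n : Type*} [Fintype n] [DecidableEq n]
    {r : ℕ} (M : Matrix n n F) (lam : Fin r → ℕ) : Prop :=
  Antitone lam ∧ (∀ i, 0 < lam i) ∧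
    ∀ k : ℕ, ((M - 1) ^ k).rank = ∑ i, (lam i - k)

/-- Rectangular shift matrix: entry one exactly where `j = i + t`. -/
def shiftMat (F : Type*) [Zero F] [One F] (a b : ℕ) (t : ℤ) : Matrix (Fin a) (Fin b) F :=
  Matrix.of fun i j => if ((j : ℕ) : ℤ) = ((i : ℕ) : ℤ) + t then 1 else 0

theorem shiftMat_mul {F : Type*} [Field F] (a b c : ℕ) (t u : ℤ)
    (h : ∀ i k : ℕ, i < a → k < c → (k : ℤ) = i + t + u → 0 ≤ (i : ℤ) + t ∧ (i : ℤ) + t < b) :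
    shiftMat F a b t * shiftMat F b c u = shiftMat F a c (t + u) := by
  ext i k
  simp only [Matrix.mul_apply, shiftMat, Matrix.of_apply]
  by_cases hk : ((k : ℕ) : ℤ) = ((i : ℕ) : ℤ) + t + u
  · obtain ⟨h0, h1⟩ := h i k i.2 k.2 hk
    rw [Finset.sum_eq_single (⟨((i : ℕ) + t).toNat, by omega⟩ : Fin b)]
    · have e : ((((i : ℕ) + t).toNat : ℕ) : ℤ) = (i : ℕ) + t := by omega
      simp only [e]
      rw [if_pos trivial, if_pos hk, if_pos (by omega)]; simp
    · intro j _ hj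
      rw [if_neg, zero_mul]
      intro hj'
      apply hj
      ext
      simp only
      omega
    · simp
  · rw [if_neg (by omega)]
    apply Finset.sum_eq_zero
    intro j _
    by_cases h1 : ((j : ℕ) : ℤ) = ((i : ℕ) : ℤ) + t
    · have h2 : ¬ ((k : ℕ) : ℤ) = ((j : ℕ) : ℤ) + u := by omega
      rw [if_neg h2, mul_zero]
    · rw [if_neg h1, zero_mul]

theorem shiftMat_zero {F : Type*} [Field F] (a : ℕ) : shiftMat F a a 0 = 1 := by
  ext i j
  simp only [shiftMat, Matrix.of_apply, Matrix.one_apply, Fin.ext_iff]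
  congr 1
  simp only [eq_iff_iff]; omega

theorem shiftMat_pow {F : Type*} [Field F] (a t : ℕ) :
    shiftMat F a a 1 ^ t = shiftMat F a a t := by
  induction t with
  | zero => rw [pow_zero, Nat.cast_zero, shiftMat_zero]
  | succ t ih =>
    rw [pow_succ, ih, shiftMat_mul]
    · push_cast; rfl
    · intros; omega

theorem shiftMat_big {F : Type*} [Field F] (a t : ℕ) (h : a ≤ t) :
    shiftMat F a a t = 0 := by
  ext i j
  simp only [shiftMat, Matrix.of_apply, Matrix.zero_apply]
  rw [if_neg]; omega

theorem jordanBlock_eq {F : Type*} [Field F] (a : ℕ) :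
    jordanBlock F a = 1 + shiftMat F a a 1 := by
  ext i j
  simp only [jordanBlock, shiftMat, Matrix.of_apply, Matrix.add_apply, Matrix.one_apply]
  by_cases h : j = i
  · subst h; simp
  · rw [if_neg h, if_neg (Ne.symm h), zero_add]
    congr 1
    simp only [eq_iff_iff]; omega

/-- Nilpotent part of the tensor product. -/
def wMat (F : Type*) [Field F] (r n : ℕ) : Matrix (Fin r × Fin n) (Fin r × Fin n) F :=
  jordanBlock F r ⊗ₖ jordanBlock F n - 1

/-- Nilpotent shift on the second factor. -/
def yMat (F : Type*) [Field F] (r n : ℕ) : Matrix (Fin r × Fin n) (Fin r × Fin n) F :=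
  (1 : Matrix (Fin r) (Fin r) F) ⊗ₖ shiftMat F n n 1

theorem kron_one_pow {F : Type*} [Field F] (r n t : ℕ) (A : Matrix (Fin n) (Fin n) F) :
    ((1 : Matrix (Fin r) (Fin r) F) ⊗ₖ A) ^ t = (1 : Matrix (Fin r) (Fin r) F) ⊗ₖ (A ^ t) := by
  induction t with
  | zero => simp
  | succ t ih => rw [pow_succ, ih, ← Matrix.mul_kronecker_mul, pow_succ, one_mul]

theorem kron_pow_one {F : Type*} [Field F] (r n t : ℕ) (A : Matrix (Fin r) (Fin r) F) :
    (A ⊗ₖ (1 : Matrix (Fin n) (Fin n) F)) ^ t = (A ^ t) ⊗ₖ (1 : Matrix (Fin n) (Fin n) F) := by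
  induction t with
  | zero => simp
  | succ t ih => rw [pow_succ, ih, ← Matrix.mul_kronecker_mul, pow_succ, one_mul]

theorem yMat_pow {F : Type*} [Field F] (r n t : ℕ) :
    yMat F r n ^ t = (1 : Matrix (Fin r) (Fin r) F) ⊗ₖ shiftMat F n n t := by
  rw [yMat, kron_one_pow, shiftMat_pow]

theorem wMat_comm {F : Type*} [Field F] (r n : ℕ) : Commute (wMat F r n) (yMat F r n) := by
  unfold wMat yMat
  apply Commute.sub_left _ (Commute.one_left _)
  unfold Commute SemiconjBy
  rw [← Matrix.mul_kronecker_mul, ← Matrix.mul_kronecker_mul, jordanBlock_eq n]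
  simp [mul_add, add_mul]

theorem rank_small {F : Type*} [Field F] (r n s k : ℕ) (h : s ≤ n) :
    (wMat F r s ^ k).rank = (wMat F r n ^ k * yMat F r n ^ (n - s)).rank := by
  set I : Matrix (Fin r × Fin n) (Fin r × Fin s) F :=
    (1 : Matrix (Fin r) (Fin r) F) ⊗ₖ shiftMat F n s 0 with hI
  set I' : Matrix (Fin r × Fin s) (Fin r × Fin n) F :=
    (1 : Matrix (Fin r) (Fin r) F) ⊗ₖ shiftMat F s n 0 with hI'
  set Q : Matrix (Fin r × Fin s) (Fin r × Fin n) F :=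
    (1 : Matrix (Fin r) (Fin r) F) ⊗ₖ shiftMat F s n ((n - s : ℕ) : ℤ) with hQ
  set Q' : Matrix (Fin r × Fin n) (Fin r × Fin s) F :=
    (1 : Matrix (Fin r) (Fin r) F) ⊗ₖ shiftMat F n s (-((n - s : ℕ) : ℤ)) with hQ'
  have e1 : I' * I = 1 := by
    rw [hI, hI', ← Matrix.mul_kronecker_mul, shiftMat_mul]
    · simp [shiftMat_zero]
    · intros; omega
  have e2 : Q * Q' = 1 := by
    rw [hQ, hQ', ← Matrix.mul_kronecker_mul, shiftMat_mul]
    · simp [shiftMat_zero]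
    · intros; omega
  have e3 : I * Q = yMat F r n ^ (n - s) := by
    rw [hI, hQ, ← Matrix.mul_kronecker_mul, shiftMat_mul, yMat_pow]
    · simp
    · intros; omega
  have e4 : wMat F r n * I = I * wMat F r s := by
    unfold wMat
    rw [Matrix.sub_mul, Matrix.mul_sub, Matrix.one_mul, Matrix.mul_one, hI,
      ← Matrix.mul_kronecker_mul, ← Matrix.mul_kronecker_mul, jordanBlock_eq n, jordanBlock_eq s,
      Matrix.add_mul, Matrix.mul_add, shiftMat_mul, shiftMat_mul]
    · simp
    · intros; omega
    · intros; omega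
  have e5 : wMat F r n ^ k * I = I * wMat F r s ^ k := by
    induction k with
    | zero => simp
    | succ k ih =>
      rw [pow_succ, Matrix.mul_assoc, e4, ← Matrix.mul_assoc, ih, Matrix.mul_assoc, ← pow_succ]
  rw [← e3, ← Matrix.mul_assoc, e5]
  apply le_antisymm
  · have : wMat F r s ^ k = I' * ((I * wMat F r s ^ k * Q) * Q') := by
      rw [Matrix.mul_assoc _ Q, e2, Matrix.mul_one, ← Matrix.mul_assoc, e1, Matrix.one_mul]
    calc (wMat F r s ^ k).rank = (I' * ((I * wMat F r s ^ k * Q) * Q')).rank := by rw [← this]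
      _ ≤ _ := (Matrix.rank_mul_le_right _ _).trans (Matrix.rank_mul_le_left _ _)
  · exact (Matrix.rank_mul_le_left _ _).trans (Matrix.rank_mul_le_right _ _)

theorem wMat_add_one {F : Type*} [Field F] (r n : ℕ) :
    wMat F r n + 1 = (shiftMat F r r 1 ⊗ₖ (1 : Matrix (Fin n) (Fin n) F) + 1) *
      (yMat F r n + 1) := by
  unfold wMat yMat
  rw [sub_add_cancel, jordanBlock_eq, jordanBlock_eq, add_mul, mul_add, mul_add,
    ← Matrix.mul_kronecker_mul, Matrix.add_kronecker, Matrix.kronecker_add, Matrix.kronecker_add]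
  simp
  abel

theorem wMat_pow_q {F : Type*} [Field F] (p : ℕ) [CharP F p] (hp : p.Prime)
    (m r n : ℕ) (h : r ≤ p ^ m) : wMat F r n ^ (p ^ m) = yMat F r n ^ (p ^ m) := by
  rcases isEmpty_or_nonempty (Fin r × Fin n) with he | he
  · exact Subsingleton.elim _ _
  have : Fact p.Prime := ⟨hp⟩
  have hX : (shiftMat F r r 1 ⊗ₖ (1 : Matrix (Fin n) (Fin n) F)) ^ (p ^ m) = 0 := by
    rw [kron_pow_one, shiftMat_pow, shiftMat_big _ _ h, Matrix.zero_kronecker]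
  have hc : Commute (shiftMat F r r 1 ⊗ₖ (1 : Matrix (Fin n) (Fin n) F)) (yMat F r n) := by
    unfold Commute SemiconjBy yMat
    rw [← Matrix.mul_kronecker_mul, ← Matrix.mul_kronecker_mul]; simp
  have h1 : (wMat F r n + 1) ^ (p ^ m) = _ ^ (p ^ m) :=
    congrArg (· ^ (p ^ m)) (wMat_add_one (F := F) r n)
  rw [Commute.mul_pow, add_pow_char_pow_of_commute _ _ (Commute.one_right _), add_pow_char_pow_of_commute _ _ (Commute.one_right _),
    add_pow_char_pow_of_commute _ _ (Commute.one_right _), hX] at h1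
  · simpa using h1
  · exact ((hc.add_right (Commute.one_right _)).add_left (Commute.one_left _))

theorem ker_w {F : Type*} [Field F] (r n : ℕ) :
    Module.finrank F (LinearMap.ker (wMat F r n).mulVecLin) ≤ r := by
  rcases Nat.eq_zero_or_pos n with hn | hn
  · subst hn
    have : Module.finrank F (LinearMap.ker (wMat F r 0).mulVecLin) ≤ 0 :=
      (Submodule.finrank_le _).trans (by simp)
    omega
  let π : (Fin r × Fin n → F) →ₗ[F] (Fin r → F) :=
    LinearMap.funLeft F F (fun i => (i, (⟨0, hn⟩ : Fin n)))
  have hinj : Function.Injective (π.domRestrict (LinearMap.ker (wMat F r n).mulVecLin)) := by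
    rw [← LinearMap.ker_eq_bot, LinearMap.ker_eq_bot']
    rintro ⟨v, hv⟩ h0
    have h0' : ∀ i, v (i, ⟨0, hn⟩) = 0 := fun i => congrFun h0 i
    have hJ : ∀ i j, ∑ a, ∑ b, jordanBlock F r i a * jordanBlock F n j b * v (a, b) = v (i, j) := by
      intro i j
      have := congrFun (LinearMap.mem_ker.1 hv) (i, j)
      rw [wMat, Matrix.mulVecLin_apply, Matrix.sub_mulVec, Matrix.one_mulVec,
        Pi.sub_apply, Pi.zero_apply, sub_eq_zero] at this
      simp only [Matrix.mulVec, dotProduct,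
        Fintype.sum_prod_type, Matrix.kroneckerMap_apply] at this
      exact this
    have key : ∀ j : ℕ, ∀ hj : j < n, ∀ i, v (i, ⟨j, hj⟩) = 0 := by
      intro j
      induction j with
      | zero => intro hj i; exact h0' i
      | succ j ih =>
        intro hj
        have hj0 := ih (by omega)
        have hd : ∀ d : ℕ, ∀ i : Fin r, (i : ℕ) + d + 1 = r → v (i, ⟨j + 1, hj⟩) = 0 := by
          intro d
          induction d using Nat.strong_induction_on with
          | _ d ihd =>
            intro i hi
            have := hJ i ⟨j, by omega⟩
            rw [hj0 i] at this
            rw [Finset.sum_eq_single i, Finset.sum_eq_single ⟨j + 1, hj⟩] at this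
            · simpa [jordanBlock] using this
            · intro b _ hb
              by_cases hb' : b = ⟨j, by omega⟩
              · rw [hb', hj0 i, mul_zero]
              · have : (b : ℕ) ≠ j + 1 := fun h => hb (Fin.ext h)
                simp [jordanBlock, hb', this]
            · simp
            · intro a _ ha
              apply Finset.sum_eq_zero
              intro b _
              by_cases ha' : (a : ℕ) = i + 1
              · by_cases hb' : b = ⟨j, by omega⟩
                · rw [hb', hj0 a, mul_zero]
                · by_cases hb2 : b = ⟨j + 1, hj⟩
                  · rw [hb2, ihd (d - 1) (by omega) a (by omega), mul_zero]
                  · have : (b : ℕ) ≠ j + 1 := fun h => hb2 (Fin.ext h)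
                    simp [jordanBlock, hb', this]
              · simp [jordanBlock, ha', ha]
            · simp
        intro i
        exact hd (r - i - 1) i (by omega)
    ext ⟨i, j⟩
    exact key j j.2 i
  simpa using LinearMap.finrank_le_finrank_of_injective hinj

theorem finrank_comp {F V : Type*} [Field F] [AddCommGroup V] [Module F V] [FiniteDimensional F V]
    (f g : V →ₗ[F] V) :
    Module.finrank F (LinearMap.range (f ∘ₗ g)) +
      Module.finrank F (LinearMap.range g ⊓ LinearMap.ker f : Submodule F V) =
      Module.finrank F (LinearMap.range g) := by
  have h := LinearMap.finrank_range_add_finrank_ker (f.domRestrict (LinearMap.range g))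
  rw [LinearMap.range_domRestrict, ← LinearMap.range_comp, LinearMap.ker_domRestrict] at h
  rw [← h, ← Submodule.map_comap_subtype,
    (Submodule.equivMapOfInjective _ (Submodule.subtype_injective _) _).finrank_eq]

theorem finrank_ker_comp {F V : Type*} [Field F] [AddCommGroup V] [Module F V]
    [FiniteDimensional F V] (f g : V →ₗ[F] V) :
    Module.finrank F (LinearMap.ker (f ∘ₗ g)) ≤
      Module.finrank F (LinearMap.ker f) + Module.finrank F (LinearMap.ker g) := by
  have h := finrank_comp f g
  have h1 := LinearMap.finrank_range_add_finrank_ker (f ∘ₗ g)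
  have h2 := LinearMap.finrank_range_add_finrank_ker g
  have h3 : Module.finrank F (LinearMap.range g ⊓ LinearMap.ker f : Submodule F V) ≤
    Module.finrank F (LinearMap.ker f) := Submodule.finrank_mono inf_le_right
  omega

theorem finrank_ker_pow {F V : Type*} [Field F] [AddCommGroup V] [Module F V]
    [FiniteDimensional F V] (w : Module.End F V) (r k : ℕ)
    (h : Module.finrank F (LinearMap.ker w) ≤ r) :
    Module.finrank F (LinearMap.ker (w ^ k)) ≤ k * r := by
  induction k with
  | zero => simp [Module.End.one_eq_id]
  | succ k ih =>
    rw [pow_succ]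
    have := finrank_ker_comp (w ^ k) w
    rw [Module.End.mul_eq_comp]
    rw [add_mul]; omega

theorem range_le_ker {F V : Type*} [Field F] [AddCommGroup V] [Module F V]
    (f g : Module.End F V) (h : f * g = 0) : LinearMap.range g ≤ LinearMap.ker f := by
  rintro _ ⟨x, rfl⟩
  exact LinearMap.congr_fun h x

/-- The abstract duality for two commuting nilpotent operators. -/
theorem abstract_dual {F V : Type*} [Field F] [AddCommGroup V] [Module F V]
    [FiniteDimensional F V] (w y : Module.End F V) (hc : Commute w y) (r s s' k k' : ℕ)
    (hV : Module.finrank F V = r * (s + s')) (hk : k + k' = s + s')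
    (hw : w ^ (s + s') = 0) (hy : y ^ (s + s') = 0)
    (hkw : Module.finrank F (LinearMap.ker w) ≤ r)
    (hy1 : Module.finrank F (LinearMap.range (y ^ s')) = r * s)
    (hy2 : Module.finrank F (LinearMap.range (y ^ s)) = r * s') :
    Module.finrank F (LinearMap.range (w ^ k * y ^ s')) + r * k =
      Module.finrank F (LinearMap.range (w ^ k' * y ^ s)) + r * s := by
  have a1 := finrank_ker_pow w r k hkw
  have a2 := finrank_ker_pow w r k' hkw
  have b1 := LinearMap.finrank_range_add_finrank_ker (w ^ k)
  have b2 := LinearMap.finrank_range_add_finrank_ker (w ^ k')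
  have b3 := LinearMap.finrank_range_add_finrank_ker (y ^ s)
  have le1 : LinearMap.range (w ^ k') ≤ LinearMap.ker (w ^ k) :=
    range_le_ker _ _ (by rw [← pow_add, hk, hw])
  have le2 : LinearMap.range (y ^ s') ≤ LinearMap.ker (y ^ s) :=
    range_le_ker _ _ (by rw [← pow_add, hy])
  have c1 := Submodule.finrank_mono le1
  have hE : r * (s + s') = k * r + k' * r := by rw [← hk]; ring
  have hE' : r * (s + s') = r * s + r * s' := by ring
  have hkr : r * k = k * r := mul_comm _ _
  have eq1 : LinearMap.range (w ^ k') = LinearMap.ker (w ^ k) :=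
    Submodule.eq_of_le_of_finrank_eq le1 (by omega)
  have eq2 : LinearMap.range (y ^ s') = LinearMap.ker (y ^ s) :=
    Submodule.eq_of_le_of_finrank_eq le2 (by omega)
  have d1 := finrank_comp (w ^ k) (y ^ s')
  have d2 := finrank_comp (y ^ s) (w ^ k')
  rw [← eq1] at d1
  rw [← eq2, inf_comm] at d2
  rw [(hc.pow_pow k' s).eq, Module.End.mul_eq_comp, Module.End.mul_eq_comp]
  omega

theorem antitone_aux {r : ℕ} (a b : Fin r → ℕ) (hb : Antitone b)
    (h : ∀ k, ∑ i, (a i - k) = ∑ i, (b i - k)) (i : Fin r) (hlt : ∀ j < i, a j = b j) :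
    a i ≤ b i := by
  by_contra! hi
  have := h (b i)
  refine absurd this (ne_of_gt ?_)
  apply Finset.sum_lt_sum
  · intro j _
    rcases lt_or_ge j i with hj | hj
    · rw [hlt j hj]
    · have := hb hj
      omega
  · exact ⟨i, Finset.mem_univ _, by omega⟩

theorem antitone_eq {r : ℕ} (a b : Fin r → ℕ) (ha : Antitone a) (hb : Antitone b)
    (h : ∀ k, ∑ i, (a i - k) = ∑ i, (b i - k)) (i : Fin r) : a i = b i := by
  induction i using WellFoundedLT.induction with
  | _ i ih =>
    exact le_antisymm (antitone_aux a b hb h i ih)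
      (antitone_aux b a ha (fun k => (h k).symm) i (fun j hj => (ih j hj).symm))

theorem rank_dual {F : Type*} [Field F] (p : ℕ) [CharP F p] (hp : p.Prime)
    (m r s s' k k' : ℕ) (hrpm : r ≤ p ^ m) (hcong : p ^ m ∣ s + s') (hk : k + k' = s + s') :
    (wMat F r s ^ k).rank + r * k = (wMat F r s' ^ k').rank + r * s := by
  have e1 := fun k => rank_small (F := F) r (s + s') s k (by omega)
  have e2 := fun k => rank_small (F := F) r (s + s') s' k (by omega)
  rw [Nat.add_sub_cancel_left] at e1
  rw [Nat.add_sub_cancel_right] at e2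
  have hyn : yMat F r (s + s') ^ (s + s') = 0 := by
    rw [yMat_pow, shiftMat_big _ _ le_rfl, Matrix.kronecker_zero]
  have hwn : wMat F r (s + s') ^ (s + s') = 0 := by
    obtain ⟨c, hc⟩ := hcong
    rw [← hyn]
    have E := wMat_pow_q (F := F) p hp m r (s + s') hrpm
    generalize wMat F r (s + s') = W, yMat F r (s + s') = Y at E ⊢
    have hN : ∀ N, N = p ^ m * c → W ^ N = Y ^ N := by
      rintro N rfl
      rw [pow_mul, pow_mul, E]
    exact hN _ hc
  have f1 := e1 0
  have f2 := e2 0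
  simp only [pow_zero, one_mul, Matrix.rank_one, Fintype.card_prod, Fintype.card_fin] at f1 f2
  let φ : Matrix (Fin r × Fin (s + s')) (Fin r × Fin (s + s')) F →ₐ[F]
    Module.End F (Fin r × Fin (s + s') → F) := (Matrix.toLinAlgEquiv' (R := F)).toAlgHom
  have g : ∀ A, A.rank = Module.finrank F (LinearMap.range (φ A)) := fun _ => rfl
  rw [e1, e2]
  rw [g, map_pow] at f1 f2
  rw [g, g, map_mul, map_mul, map_pow, map_pow, map_pow, map_pow]
  apply abstract_dual _ _ _ r s s' k k' _ hk _ _ _ f1.symm f2.symm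
  · exact (wMat_comm r (s + s')).map φ
  · simp
  · rw [← map_pow, hwn, map_zero]
  · rw [← map_pow, hyn, map_zero]
  · exact ker_w r (s + s')

/-- Duality: if `r ≤ min{s, s', p^m}` and `s' ≡ -s (mod p^m)`, then the
deviation vector of `λ(r,s',p)` is the negative reverse of that of `λ(r,s,p)`:
`ε'_i = -ε_{r+1-i}`. -/
theorem stmt14 (F : Type*) [Field F] (p : ℕ) [CharP F p] (hp : p.Prime)
    (m r s s' : ℕ) (hr : 1 ≤ r) (hrpm : r ≤ p ^ m) (hs : r ≤ s) (hs' : r ≤ s')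
    (hcong : p ^ m ∣ s + s')
    (lam lam' : Fin r → ℕ)
    (h1 : IsJordanSeq (jordanBlock F r ⊗ₖ jordanBlock F s) lam)
    (h2 : IsJordanSeq (jordanBlock F r ⊗ₖ jordanBlock F s') lam') :
    ∀ i : Fin r, (lam' i : ℤ) - (s' : ℤ) = -((lam i.rev : ℤ) - (s : ℤ)) := by
  obtain ⟨ha, -, hl⟩ := h1
  obtain ⟨ha', -, hl'⟩ := h2
  have D := fun k k' hk => rank_dual (F := F) p hp m r s s' k k' hrpm hcong hk
  have D' := fun k k' hk => rank_dual (F := F) p hp m r s' s k k' hrpm (by rwa [add_comm]) hk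
  simp only [wMat, hl, hl'] at D D'
  have hsum : ∑ i, lam i = r * s := by
    have := hl 0
    simpa using this.symm
  have hsum' : ∑ i, lam' i = r * s' := by
    have := hl' 0
    simpa using this.symm
  have z : ∑ i, (lam i - (s + s')) = 0 := by
    have := D (s + s') 0 (by omega)
    simp only [Nat.sub_zero, hsum', mul_add] at this
    omega
  have z' : ∑ i, (lam' i - (s + s')) = 0 := by
    have := D' (s + s') 0 (by omega)
    simp only [Nat.sub_zero, hsum, mul_add] at this
    omega
  rw [Finset.sum_eq_zero_iff] at z z'
  have le : ∀ i, lam i ≤ s + s' := fun i => by have := z i (Finset.mem_univ _); omega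
  have le' : ∀ i, lam' i ≤ s + s' := fun i => by have := z' i (Finset.mem_univ _); omega
  set mu : Fin r → ℕ := fun i => s + s' - lam' i.rev with hmu
  have hmua : Antitone mu := by
    intro i j hij
    have : lam' i.rev ≤ lam' j.rev := ha' (Fin.rev_le_rev.2 hij)
    simp only [hmu]; omega
  have hre : ∀ f : Fin r → ℕ, ∑ i : Fin r, f i.rev = ∑ i, f i := fun f =>
    Equiv.sum_comp Fin.revPerm f
  have hE : ∀ k, ∑ i, (lam i - k) = ∑ i, (mu i - k) := by
    intro k
    rcases le_or_gt k (s + s') with hk | hk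
    · have h := D k (s + s' - k) (by omega)
      have h3 : ∑ i, (mu i - k) = ∑ i, (s + s' - lam' i - k) := hre (fun i => s + s' - lam' i - k)
      have h4 : ∑ i, (s + s' - lam' i - k) + ∑ i, lam' i + ∑ i : Fin r, k
          = ∑ i, (lam' i - (s + s' - k)) + ∑ i : Fin r, (s + s') := by
        rw [← Finset.sum_add_distrib, ← Finset.sum_add_distrib, ← Finset.sum_add_distrib]
        apply Finset.sum_congr rfl
        intro i _
        have := le' i
        omega
      simp only [Finset.sum_const, Finset.card_univ, Fintype.card_fin, smul_eq_mul, hsum',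
        mul_add] at h4
      omega
    · rw [Finset.sum_eq_zero, Finset.sum_eq_zero]
      · intro i _; simp only [hmu]; omega
      · intro i _; have := le i; omega
  intro i
  have h := antitone_eq lam mu ha hmua hE i.rev
  have := le' i
  simp only [hmu, Fin.rev_rev] at h
  omega
end

section
/- Let char F = p > 0 and 2 \u2264 r \u2264 min{s, p^m} with m = \u2308log_p r\u2309. If s \u2261 2 (mod p^m), then \u03b5(r,s,p) = (r-2, r-2, -2, \u2026, -2) when p divides r, and \u03b5(r,s,p) = (r-1, r-3, -2, \u2026, -2) when p does not divide r. -/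
open Matrix Kronecker

/-- The nilpotent part of the Jordan block. -/
def nilBlock (F : Type*) [Field F] (k : ℕ) : Matrix (Fin k) (Fin k) F := jordanBlock F k - 1

theorem nilBlock_apply (F : Type*) [Field F] (k : ℕ) (i j : Fin k) :
    nilBlock F k i j = if (j : ℕ) = (i : ℕ) + 1 then 1 else 0 := by
  unfold nilBlock jordanBlock
  rw [Matrix.sub_apply, Matrix.of_apply, Matrix.one_apply]
  by_cases h : j = i
  · subst h; simp
  · have h2 : ¬ i = j := fun e => h e.symm
    rw [if_neg h, if_neg h2, sub_zero]

theorem nilBlock_pow_apply (F : Type*) [Field F] (k n : ℕ) (i j : Fin k) :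
    (nilBlock F k ^ n) i j = if (j : ℕ) = (i : ℕ) + n then 1 else 0 := by
  induction n generalizing i j with
  | zero =>
    rw [pow_zero, Matrix.one_apply]
    by_cases h : i = j
    · subst h; simp
    · rw [if_neg h, if_neg]
      intro h'; exact h (Fin.ext (by omega))
  | succ n ih =>
    rw [pow_succ', Matrix.mul_apply]
    simp only [nilBlock_apply, ih]
    by_cases h : (i : ℕ) + 1 < k
    · rw [Finset.sum_eq_single (⟨i + 1, h⟩ : Fin k)]
      · simp only [if_true, one_mul]
        congr 1
        apply propext; constructor <;> intro h <;> omega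
      · intro b _ hb
        rw [if_neg, zero_mul]
        intro h'; exact hb (Fin.ext h')
      · simp
    · rw [if_neg (by have := j.2; omega)]
      apply Finset.sum_eq_zero
      intro b _
      rw [if_neg (by have := b.2; omega), zero_mul]

theorem nilBlock_pow_eq_zero (F : Type*) [Field F] (k n : ℕ) (h : k ≤ n) :
    nilBlock F k ^ n = 0 := by
  ext i j
  rw [nilBlock_pow_apply, if_neg (by have := j.2; omega)]; rfl

theorem kron_pow {F : Type*} [Field F] {a b : ℕ} (A : Matrix (Fin a) (Fin a) F)
    (B : Matrix (Fin b) (Fin b) F) (n : ℕ) : (A ⊗ₖ B) ^ n = (A ^ n) ⊗ₖ (B ^ n) := by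
  induction n with
  | zero => simp
  | succ n ih => rw [pow_succ, ih, ← Matrix.mul_kronecker_mul, ← pow_succ, ← pow_succ]

theorem pow_q (F : Type*) [Field F] (p : ℕ) [CharP F p] (hp : p.Prime)
    (m r s : ℕ) (hr : r ≤ p ^ m) (hr0 : 0 < r) (hs0 : 0 < s) :
    (jordanBlock F r ⊗ₖ jordanBlock F s - 1) ^ (p ^ m) = 1 ⊗ₖ (nilBlock F s ^ (p ^ m)) := by
  have : Fact p.Prime := ⟨hp⟩
  have : Nonempty (Fin r) := ⟨⟨0, hr0⟩⟩
  have : Nonempty (Fin s) := ⟨⟨0, hs0⟩⟩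
  have h1 : jordanBlock F r ^ (p ^ m) = 1 := by
    have : nilBlock F r ^ (p ^ m) = jordanBlock F r ^ (p ^ m) - 1 ^ (p ^ m) :=
      sub_pow_char_pow_of_commute p m (Commute.one_right _)
    rw [nilBlock_pow_eq_zero F r _ hr, one_pow] at this
    exact (sub_eq_zero.mp this.symm)
  have h2 : nilBlock F s ^ (p ^ m) = jordanBlock F s ^ (p ^ m) - 1 := by
    have : nilBlock F s ^ (p ^ m) = jordanBlock F s ^ (p ^ m) - 1 ^ (p ^ m) :=
      sub_pow_char_pow_of_commute p m (Commute.one_right _)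
    rwa [one_pow] at this
  rw [sub_pow_char_pow_of_commute p m (Commute.one_right _), one_pow, kron_pow, h1, h2]
  ext ⟨i, j⟩ ⟨i', j'⟩
  simp only [Matrix.sub_apply, Matrix.kroneckerMap_apply, Matrix.one_apply, Prod.mk.injEq]
  split_ifs <;> simp_all

theorem jordan_sub (F : Type*) [Field F] (r s : ℕ) :
    jordanBlock F r ⊗ₖ jordanBlock F s - 1 =
      nilBlock F r ⊗ₖ (1 + nilBlock F s) + 1 ⊗ₖ nilBlock F s := by
  have h1 : jordanBlock F r = 1 + nilBlock F r := by unfold nilBlock; abel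
  have h2 : jordanBlock F s = 1 + nilBlock F s := by unfold nilBlock; abel
  rw [h1, h2, Matrix.add_kronecker, Matrix.kronecker_add 1, Matrix.one_kronecker_one]
  abel

theorem main_formula (F : Type*) [Field F] (r t j : ℕ)
    (h0 : (jordanBlock F r ⊗ₖ jordanBlock F (t + 2) - 1) ^ t = 1 ⊗ₖ (nilBlock F (t + 2) ^ t)) :
    (jordanBlock F r ⊗ₖ jordanBlock F (t + 2) - 1) ^ (t + j) =
      (nilBlock F r ^ j) ⊗ₖ (nilBlock F (t + 2) ^ t + (j : F) • nilBlock F (t + 2) ^ (t + 1)) +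
      (j : F) • ((nilBlock F r ^ (j - 1)) ⊗ₖ (nilBlock F (t + 2) ^ (t + 1))) := by
  induction j with
  | zero => simp [h0]
  | succ j ih =>
    rw [← add_assoc, pow_succ', ih, jordan_sub]
    have hz := nilBlock_pow_eq_zero F (t + 2) (t + 2) le_rfl
    set X := nilBlock F r
    set Y := nilBlock F (t + 2)
    have e0 : Y * Y ^ t = Y ^ (t + 1) := (pow_succ' Y t).symm
    have e1 : Y * Y ^ (t + 1) = 0 := by rw [← pow_succ']; exact hz
    have e2 : (j : F) • (X * X ^ (j - 1)) = (j : F) • X ^ j := by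
      cases j with
      | zero => simp
      | succ j => rw [← pow_succ']; simp
    have e3 : X * X ^ j = X ^ (j + 1) := (pow_succ' X j).symm
    rw [add_mul, mul_add, mul_add, Matrix.mul_smul, Matrix.mul_smul, ← Matrix.mul_kronecker_mul,
      ← Matrix.mul_kronecker_mul, ← Matrix.mul_kronecker_mul, ← Matrix.mul_kronecker_mul,
      ← Matrix.smul_kronecker, e2, e3]
    simp only [add_mul, mul_add, one_mul, Matrix.mul_smul, e0, e1, smul_zero, add_zero,
      Matrix.kronecker_zero, Nat.add_sub_cancel, Matrix.kronecker_add, Nat.cast_add, Nat.cast_one,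
      add_smul, one_smul, Matrix.smul_kronecker, Matrix.kronecker_smul]
    abel

theorem rank_upper (F : Type*) [Field F] (r t : ℕ) :
    ((1 : Matrix (Fin r) (Fin r) F) ⊗ₖ (nilBlock F (t + 2) ^ t)).rank ≤ 2 * r := by
  have : nilBlock F (t + 2) ^ t =
      (Matrix.of fun (i : Fin (t + 2)) (u : Fin 2) => if (i : ℕ) = u then (1 : F) else 0) *
      (Matrix.of fun (u : Fin 2) (j : Fin (t + 2)) => if (j : ℕ) = u + t then (1 : F) else 0) := by
    ext i j
    rw [nilBlock_pow_apply, Matrix.mul_apply, Fin.sum_univ_two]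
    simp only [Matrix.of_apply, Fin.val_zero, Fin.val_one]
    have := j.2
    split_ifs <;> first | omega | simp
  rw [this, ← Matrix.one_mul (1 : Matrix (Fin r) (Fin r) F), Matrix.mul_kronecker_mul]
  refine (Matrix.rank_mul_le_left _ _).trans ((Matrix.rank_le_card_width _).trans ?_)
  simp [mul_comm]

theorem rank_lower (F : Type*) [Field F] (r t j : ℕ) (hj : j ≤ r)
    (h0 : (jordanBlock F r ⊗ₖ jordanBlock F (t + 2) - 1) ^ t = 1 ⊗ₖ (nilBlock F (t + 2) ^ t)) :
    2 * (r - j) ≤ ((jordanBlock F r ⊗ₖ jordanBlock F (t + 2) - 1) ^ (t + j)).rank := by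
  rw [main_formula F r t j h0]
  set M := (nilBlock F r ^ j) ⊗ₖ (nilBlock F (t + 2) ^ t + (j : F) • nilBlock F (t + 2) ^ (t + 1)) +
      (j : F) • ((nilBlock F r ^ (j - 1)) ⊗ₖ (nilBlock F (t + 2) ^ (t + 1))) with hM
  let f : Fin (r - j) ⊕ Fin (r - j) → Fin r × Fin (t + 2) :=
    Sum.elim (fun i => (⟨i, by omega⟩, ⟨0, by omega⟩)) (fun i => (⟨i, by omega⟩, ⟨1, by omega⟩))
  let g : Fin (r - j) ⊕ Fin (r - j) → Fin r × Fin (t + 2) :=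
    Sum.elim (fun i => (⟨i + j, by omega⟩, ⟨t, by omega⟩))
      (fun i => (⟨i + j, by omega⟩, ⟨t + 1, by omega⟩))
  have hb : M.submatrix f g = Matrix.fromBlocks 1 (M.submatrix f g).toBlocks₁₂ 0 1 := by
    conv_lhs => rw [← Matrix.fromBlocks_toBlocks (M.submatrix f g)]
    congr 1 <;> ext a b <;>
      simp [Matrix.toBlocks₁₁, Matrix.toBlocks₂₁, Matrix.toBlocks₂₂, f, g, hM,
        nilBlock_pow_apply, Matrix.one_apply, Fin.ext_iff, eq_comm, add_comm]
    rw [if_neg (by omega), if_neg (by omega), add_zero]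
  have hd : (M.submatrix f g).det = 1 := by
    rw [hb, Matrix.det_fromBlocks_zero₂₁]; simp
  have hr := Matrix.rank_of_isUnit (M.submatrix f g)
    ((Matrix.isUnit_iff_isUnit_det _).mpr (by rw [hd]; exact isUnit_one))
  have h3 : (M.submatrix f g).rank ≤ M.rank := by
    exact Matrix.rank_submatrix_le M f g
  rw [hr] at h3
  simp at h3
  omega

theorem eq_zero_of_rank {F : Type*} [Field F] {n : Type*} [Fintype n] [DecidableEq n]
    (M : Matrix n n F) (h : M.rank = 0) : M = 0 := by
  unfold Matrix.rank at h
  rw [Submodule.finrank_eq_zero, LinearMap.range_eq_bot] at h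
  ext i j
  have := congrFun (LinearMap.congr_fun h (Pi.single j 1)) i
  simpa using this

theorem sum_eq_head {t c : ℕ} (mu : Fin (t + 2) → ℕ) (ha : Antitone mu) (h : mu 1 ≤ c) :
    ∑ i, (mu i - c) = mu 0 - c := by
  rw [Fin.sum_univ_succ, Finset.sum_eq_zero, add_zero]
  intro i _
  have : mu i.succ ≤ mu 1 := ha (by rw [Fin.le_def]; simp)
  omega

/-- If `p^{m-1} < r ≤ min{s, p^m}`, `2 ≤ r`, and `s ≡ 2 (mod p^m)`, then
`ε(r,s,p) = (r-2, r-2, -2, …, -2)` when `p ∣ r`, and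
`ε(r,s,p) = (r-1, r-3, -2, …, -2)` when `p ∤ r`. -/
theorem stmt18 (F : Type*) [Field F] (p : ℕ) [CharP F p] (hp : p.Prime)
    (m r s : ℕ) (hm : p ^ (m - 1) < r) (hrpm : r ≤ p ^ m) (hr2 : 2 ≤ r)
    (hrs : r ≤ s) (hcong : s % p ^ m = 2)
    (lam : Fin r → ℕ)
    (hlam : IsJordanSeq (jordanBlock F r ⊗ₖ jordanBlock F s) lam) :
    (p ∣ r →
      (∀ i : Fin r, (i : ℕ) = 0 ∨ (i : ℕ) = 1 → lam i = s + r - 2) ∧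
      (∀ i : Fin r, 2 ≤ (i : ℕ) → lam i = s - 2)) ∧
    (¬ p ∣ r →
      (∀ i : Fin r, (i : ℕ) = 0 → lam i = s + r - 1) ∧
      (∀ i : Fin r, (i : ℕ) = 1 → lam i = s + r - 3) ∧
      (∀ i : Fin r, 2 ≤ (i : ℕ) → lam i = s - 2)) := by
  obtain ⟨t, rfl⟩ : ∃ t, s = t + 2 := ⟨s - 2, by omega⟩
  obtain ⟨hanti, -, hrank⟩ := hlam
  have h0 : (jordanBlock F r ⊗ₖ jordanBlock F (t + 2) - 1) ^ t =
      1 ⊗ₖ (nilBlock F (t + 2) ^ t) := by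
    have ht : t = p ^ m * ((t + 2) / p ^ m) := by
      have := Nat.div_add_mod (t + 2) (p ^ m)
      omega
    have hq := pow_q F p hp m r (t + 2) hrpm (by omega) (by omega)
    generalize (t + 2) / p ^ m = a at ht
    calc _ = (jordanBlock F r ⊗ₖ jordanBlock F (t + 2) - 1) ^ (p ^ m * a) := by rw [← ht]
      _ = 1 ⊗ₖ (nilBlock F (t + 2) ^ (p ^ m * a)) := by
        rw [pow_mul, hq, kron_pow, one_pow, ← pow_mul]
      _ = _ := by rw [← ht]
  -- total size
  have hsum : ∑ i, lam i = r * (t + 2) := by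
    have := hrank 0
    simp only [pow_zero, Matrix.rank_one, Nat.sub_zero] at this
    rw [← this]; simp
  have hle : ∑ i, (lam i - t) ≤ 2 * r := by
    rw [← hrank t, h0]; exact rank_upper F r t
  have hge : ∀ i, t ≤ lam i := by
    by_contra! hcon
    obtain ⟨i, hi⟩ := hcon
    have : ∑ i, lam i < ∑ i, ((lam i - t) + t) :=
      Finset.sum_lt_sum (fun i _ => by omega) ⟨i, Finset.mem_univ _, by omega⟩
    rw [Finset.sum_add_distrib, hsum] at this
    simp only [Finset.sum_const, Finset.card_univ, Fintype.card_fin, smul_eq_mul] at this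
    have h : r * (t + 2) = r * t + 2 * r := by ring
    omega
  obtain ⟨mu, hmu⟩ : ∃ mu : Fin r → ℕ, ∀ i, lam i = mu i + t :=
    ⟨fun i => lam i - t, fun i => by have := hge i; dsimp only; omega⟩
  have hma : Antitone mu := fun i j hij => by
    have := hanti hij
    rw [hmu, hmu] at this
    omega
  have hms : ∑ i, mu i = 2 * r := by
    simp only [hmu, Finset.sum_add_distrib, Finset.sum_const, Finset.card_univ,
      Fintype.card_fin, smul_eq_mul] at hsum
    have h : r * (t + 2) = r * t + 2 * r := by ring
    omega
  have hmr : ∀ j, ((jordanBlock F r ⊗ₖ jordanBlock F (t + 2) - 1) ^ (t + j)).rank =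
      ∑ i, (mu i - j) := by
    intro j
    rw [hrank]
    apply Finset.sum_congr rfl
    intro i _
    rw [hmu]; omega
  have hXr : nilBlock F r ^ r = 0 := nilBlock_pow_eq_zero F r r le_rfl
  have hlow1 := rank_lower F r t (r - 1) (by omega) h0
  have hlow2 := rank_lower F r t (r - 2) (by omega) h0
  have htop : ((jordanBlock F r ⊗ₖ jordanBlock F (t + 2) - 1) ^ (t + (r + 1))) = 0 := by
    rw [main_formula F r t _ h0, Nat.add_sub_cancel, pow_succ, hXr]
    simp
  have hr : ((jordanBlock F r ⊗ₖ jordanBlock F (t + 2) - 1) ^ (t + r)) =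
      (r : F) • ((nilBlock F r ^ (r - 1)) ⊗ₖ (nilBlock F (t + 2) ^ (t + 1))) := by
    rw [main_formula F r t _ h0, hXr]
    simp
  have htop' := hmr (r + 1)
  rw [htop, Matrix.rank_zero] at htop'
  have hmr_r := hmr r
  rw [hmr] at hlow1 hlow2
  obtain ⟨n, rfl⟩ : ∃ n, r = n + 2 := ⟨r - 2, by omega⟩
  have hms' := hms
  rw [Fin.sum_univ_succ, Fin.sum_univ_succ] at hms'
  simp only [Fin.succ_zero_eq_one] at hms'
  have hrest : mu 0 + mu 1 = 2 * (n + 2) → ∀ i : Fin (n + 2), 2 ≤ (i : ℕ) → mu i = 0 := by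
    intro h i hi
    have hz : ∑ i : Fin n, mu i.succ.succ = 0 := by omega
    rw [Finset.sum_eq_zero_iff] at hz
    have := hz ⟨i - 2, by omega⟩ (Finset.mem_univ _)
    rw [← this]
    congr 1
    apply Fin.ext
    simp; omega
  have hidx0 : ∀ i : Fin (n + 2), (i : ℕ) = 0 → i = 0 := fun i h => Fin.ext (by simpa using h)
  have hidx1 : ∀ i : Fin (n + 2), (i : ℕ) = 1 → i = 1 := fun i h => Fin.ext (by simpa using h)
  have h01 : mu 1 ≤ mu 0 := hma (Fin.zero_le _)
  constructor
  · intro hpr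
    have : ((n + 2 : ℕ) : F) = 0 := (CharP.cast_eq_zero_iff F p _).mpr hpr
    rw [hr, this, zero_smul, Matrix.rank_zero] at hmr_r
    have hb := (Finset.sum_eq_zero_iff.mp hmr_r.symm) 0 (Finset.mem_univ _)
    have hm1 : n + 2 ≤ mu 1 := by
      by_contra! hcon
      rw [sum_eq_head mu hma (by omega)] at hlow1
      omega
    have hsum2 : mu 0 + mu 1 = 2 * (n + 2) := by omega
    refine ⟨?_, fun i hi => by rw [hmu, hrest hsum2 i hi]; omega⟩
    rintro i (hi | hi)
    · rw [hidx0 i hi, hmu]; omega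
    · rw [hidx1 i hi, hmu]; omega
  · intro hpr
    have hne : ((n + 2 : ℕ) : F) ≠ 0 := fun h => hpr ((CharP.cast_eq_zero_iff F p _).mp h)
    have hm0 : n + 3 ≤ mu 0 := by
      by_contra! hcon
      rw [sum_eq_head mu hma (by omega), Nat.sub_eq_zero_of_le (by omega)] at hmr_r
      replace hmr_r := eq_zero_of_rank _ hmr_r
      rw [hr] at hmr_r
      have := congrFun (congrFun hmr_r (⟨0, by omega⟩, ⟨0, by omega⟩))
        (⟨n + 1, by omega⟩, ⟨t + 1, by omega⟩)
      simp [nilBlock_pow_apply] at this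
      exact hne (by exact_mod_cast this)
    have hb := (Finset.sum_eq_zero_iff.mp htop'.symm) 0 (Finset.mem_univ _)
    have hm1 : n + 1 ≤ mu 1 := by
      by_contra! hcon
      rw [sum_eq_head mu hma (by omega)] at hlow2
      omega
    have hsum2 : mu 0 + mu 1 = 2 * (n + 2) := by omega
    refine ⟨fun i hi => ?_, fun i hi => ?_, fun i hi => by rw [hmu, hrest hsum2 i hi]; omega⟩
    · rw [hidx0 i hi, hmu]; omega
    · rw [hidx1 i hi, hmu]; omega
end
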